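/- There is an uncountable family of countable graphs no two distinct members of which are minor-twins; equivalently, the minor-twin equivalence relation on countable graphs has uncountably many equivalence classes. -/

import Mathlib

/-- `H` is a minor of `G`: pairwise disjoint nonempty connected branch sets, one for each
vertex of `H`, with a `G`-edge between the branch sets of any two `H`-adjacent vertices. -/
def IsMinor {V : Type*} {W : Type*} (H : SimpleGraph V) (G : SimpleGraph W) : Prop :=
  ∃ B : V → Set W,
    (∀ v : V, (G.induce (B v)).Connected) ∧
    (∀ u v : V, u ≠ v → Disjoint (B u) (B v)) ∧
    (∀ u v : V, H.Adj u v → ∃ x ∈ B u, ∃ y ∈ B v, G.Adj x y)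

/-- A countable graph: a simple graph together with its (countable) vertex type. -/
structure CGraph where
  V : Type
  countable : Countable V
  graph : SimpleGraph V

/-- Two graphs are minor-twins if each is a minor of the other. -/
def MinorTwins (G H : CGraph) : Prop :=
  IsMinor G.graph H.graph ∧ IsMinor H.graph G.graph

open SimpleGraph

/-- Reachability inside an induced subgraph is monotone in the vertex set. -/
theorem SimpleGraph.Reachable.induce_mono {V : Type*} {G : SimpleGraph V} {s t : Set V}
    (hst : s ⊆ t) {x y : V} {hx : x ∈ s} {hy : y ∈ s}
    (h : (G.induce s).Reachable ⟨x, hx⟩ ⟨y, hy⟩) :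
    (G.induce t).Reachable ⟨x, hst hx⟩ ⟨y, hst hy⟩ :=
  h.map (G.induceHomOfLE hst).toHom

/-- The union of connected branch sets over a connected vertex set is connected. -/
theorem connected_induce_biUnion {V W : Type*} {H : SimpleGraph V} {G : SimpleGraph W}
    {B : V → Set W} (hconn : ∀ v, (G.induce (B v)).Connected)
    (hadj : ∀ u v, H.Adj u v → ∃ x ∈ B u, ∃ y ∈ B v, G.Adj x y)
    {S : Set V} (hS : (H.induce S).Connected) :
    (G.induce (⋃ v ∈ S, B v)).Connected := by
  have hsub : ∀ v ∈ S, B v ⊆ ⋃ v ∈ S, B v := fun v hv => Set.subset_biUnion_of_mem hv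
  have key : ∀ u v : S, (H.induce S).Reachable u v → ∀ x (hx : x ∈ B u) y (hy : y ∈ B v),
      (G.induce (⋃ v ∈ S, B v)).Reachable ⟨x, hsub u u.2 hx⟩ ⟨y, hsub v v.2 hy⟩ := by
    rintro u v ⟨p⟩
    induction p with
    | nil =>
      intro x hx y hy
      exact ((hconn _).preconnected ⟨x, hx⟩ ⟨y, hy⟩).induce_mono (hsub _ (Subtype.prop _))
    | @cons u w v huw _ ih =>
      intro x hx y hy
      obtain ⟨a, ha, b, hb, hab⟩ := hadj u w huw
      have h₁ := ((hconn u).preconnected ⟨x, hx⟩ ⟨a, ha⟩).induce_mono (hsub u u.2)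
      have h₂ : (G.induce (⋃ v ∈ S, B v)).Adj ⟨a, hsub u u.2 ha⟩ ⟨b, hsub w w.2 hb⟩ := hab
      exact h₁.trans (h₂.reachable.trans (ih b hb y hy))
  obtain ⟨v⟩ := hS.nonempty
  obtain ⟨x⟩ := (hconn v).nonempty
  refine (connected_iff _).2 ⟨?_, ⟨⟨x, hsub v v.2 x.2⟩⟩⟩
  rintro ⟨x, hx⟩ ⟨y, hy⟩
  obtain ⟨u, hu, hxu⟩ := Set.mem_iUnion₂.1 hx
  obtain ⟨w, hw, hyw⟩ := Set.mem_iUnion₂.1 hy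
  exact key ⟨u, hu⟩ ⟨w, hw⟩ (hS.preconnected _ _) x hxu y hyw

/-- Every graph is a minor of itself. -/
theorem IsMinor.refl {V : Type*} (G : SimpleGraph V) : IsMinor G G := by
  refine ⟨fun v => {v}, fun v => ?_, fun u v huv => by simpa using huv,
    fun u v h => ⟨u, rfl, v, rfl, h⟩⟩
  have : Subsingleton ({v} : Set V) := Set.subsingleton_singleton.coe_sort
  exact (connected_iff _).2 ⟨Preconnected.of_subsingleton, ⟨⟨v, rfl⟩⟩⟩

/-- If the vertices of `G` can be replaced by disjoint branch sets of `G` that are all disjoint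
from, and adjacent to, a fixed connected set, then `G` has an infinite complete minor. -/
theorem isMinor_top_of_cone {V : Type*} {G : SimpleGraph V} {A : Set V} {B : V → Set V}
    (hA : (G.induce A).Connected) (hB : ∀ v, (G.induce (B v)).Connected)
    (hdisj : ∀ u v, u ≠ v → Disjoint (B u) (B v)) (hAdisj : ∀ v, Disjoint A (B v))
    (hadj : ∀ u v, G.Adj u v → ∃ x ∈ B u, ∃ y ∈ B v, G.Adj x y)
    (hAadj : ∀ v, ∃ x ∈ A, ∃ y ∈ B v, G.Adj x y) :
    IsMinor (⊤ : SimpleGraph ℕ) G := by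
  let Φ : Set V → Set V := fun S => ⋃ v ∈ S, B v
  let K : ℕ → Set V := fun n => Φ^[n] A
  have hK : ∀ n, K (n + 1) = Φ (K n) := fun n => Function.iterate_succ_apply' Φ n A
  have hconn : ∀ n, (G.induce (K n)).Connected := by
    intro n
    induction n with
    | zero => exact hA
    | succ n ih => rw [hK]; exact connected_induce_biUnion hB hadj ih
  have hlt : ∀ m k, Disjoint (K m) (K (m + k + 1)) ∧
      ∃ x ∈ K m, ∃ y ∈ K (m + k + 1), G.Adj x y := by
    intro m k
    induction m with
    | zero =>
      obtain ⟨⟨v, hv⟩⟩ := (hconn (0 + k)).nonempty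
      obtain ⟨x, hx, y, hy, hxy⟩ := hAadj v
      rw [hK]
      exact ⟨Set.disjoint_iUnion₂_right.2 fun v _ => hAdisj v,
        x, hx, y, Set.mem_biUnion hv hy, hxy⟩
    | succ m ih =>
      obtain ⟨hd, u, hu, v, hv, huv⟩ := ih
      obtain ⟨x, hx, y, hy, hxy⟩ := hadj u v huv
      rw [show m + 1 + k + 1 = (m + k + 1) + 1 by omega, hK, hK]
      refine ⟨?_, x, Set.mem_biUnion hu hx, y, Set.mem_biUnion hv hy, hxy⟩
      exact Set.disjoint_iUnion₂_left.2 fun a ha => Set.disjoint_iUnion₂_right.2 fun b hb =>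
        hdisj a b (hd.ne_of_mem ha hb)
  have hlt' : ∀ m n, m < n → Disjoint (K m) (K n) ∧ ∃ x ∈ K m, ∃ y ∈ K n, G.Adj x y := by
    intro m n hmn
    obtain ⟨k, rfl⟩ := Nat.exists_eq_add_of_lt hmn
    exact hlt m k
  refine ⟨K, hconn, fun m n hmn => ?_, fun m n hmn => ?_⟩
  · rcases hmn.lt_or_gt with h | h
    · exact (hlt' m n h).1
    · exact (hlt' n m h).1.symm
  · rcases (top_adj m n |>.1 hmn).lt_or_gt with h | h
    · exact (hlt' m n h).2
    · obtain ⟨x, hx, y, hy, hxy⟩ := (hlt' n m h).2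
      exact ⟨y, hy, x, hx, hxy.symm⟩

/-- Adjacency in the cone over the disjoint union of a family of graphs. -/
inductive ConeSumAdj {ι : Type*} {V : ι → Type*} (G : ∀ i, SimpleGraph (V i)) :
    Option (Σ i, V i) → Option (Σ i, V i) → Prop
  | apex_left (a : Σ i, V i) : ConeSumAdj G none (some a)
  | apex_right (a : Σ i, V i) : ConeSumAdj G (some a) none
  | base {i : ι} {v w : V i} : (G i).Adj v w → ConeSumAdj G (some ⟨i, v⟩) (some ⟨i, w⟩)

/-- The disjoint union of a family of graphs together with an apex adjacent to every vertex. -/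
def coneSum {ι : Type*} {V : ι → Type*} (G : ∀ i, SimpleGraph (V i)) :
    SimpleGraph (Option (Σ i, V i)) where
  Adj := ConeSumAdj G
  symm := ⟨by
    rintro _ _ (_ | _ | h)
    · exact .apex_right _
    · exact .apex_left _
    · exact .base h.symm⟩
  loopless := ⟨by
    rintro (_ | ⟨i, v⟩) h
    · cases h
    · cases h with
      | base h => exact (G i).irrefl h⟩

section coneSum

variable {ι : Type*} {V : ι → Type*} {G : ∀ i, SimpleGraph (V i)}

/-- A graph of the family having the cone as a minor has an infinite complete minor. -/
theorem isMinor_top_of_coneSum {i : ι} (h : IsMinor (coneSum G) (G i)) :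
    IsMinor (⊤ : SimpleGraph ℕ) (G i) := by
  obtain ⟨B, hconn, hdisj, hadj⟩ := h
  exact isMinor_top_of_cone (A := B none) (B := fun v => B (some ⟨i, v⟩)) (hconn _)
    (fun v => hconn _) (fun u v huv => hdisj _ _ (by simpa using huv))
    (fun v => hdisj _ _ (by simp)) (fun u v huv => hadj _ _ (.base huv))
    (fun v => hadj _ _ (.apex_left _))

/-- A walk in the cone avoiding the apex stays within one graph of the family. -/
theorem exists_reachable_of_coneSum {S : Set (Option (Σ i, V i))} (hS : none ∉ S) {i : ι}
    {x y : S} (h : ((coneSum G).induce S).Reachable x y) (v : V i)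
    (hv : x.1 = some ⟨i, v⟩) :
    ∃ w, ∃ hw : y.1 = some ⟨i, w⟩,
      ((G i).induce {u | some ⟨i, u⟩ ∈ S}).Reachable
        ⟨v, show some ⟨i, v⟩ ∈ S from hv ▸ x.2⟩ ⟨w, show some ⟨i, w⟩ ∈ S from hw ▸ y.2⟩ := by
  obtain ⟨p⟩ := h
  induction p generalizing v with
  | nil => exact ⟨v, hv, Reachable.refl _⟩
  | @cons x z y hxz _ ih =>
    obtain ⟨x, hx⟩ := x
    obtain ⟨z, hz⟩ := z
    obtain rfl : x = some ⟨i, v⟩ := hv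
    have hxz' : ConeSumAdj G _ z := hxz
    cases hxz' with
    | apex_right => exact absurd hz hS
    | @base _ _ u huv =>
      obtain ⟨w, hw, hr⟩ := ih u rfl
      refine ⟨w, hw, Reachable.trans (Adj.reachable ?_) hr⟩
      exact huv

/-- The cone over a disjoint union has an infinite complete minor only if one of the graphs of
the family does. -/
theorem exists_isMinor_top_of_coneSum (h : IsMinor (⊤ : SimpleGraph ℕ) (coneSum G)) :
    ∃ i, IsMinor (⊤ : SimpleGraph ℕ) (G i) := by
  obtain ⟨B, hconn, hdisj, hadj⟩ := h
  obtain ⟨N, hN⟩ : ∃ N, ∀ n, none ∉ B (N + n) := by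
    by_cases h : ∃ n, none ∈ B n
    · obtain ⟨m, hm⟩ := h
      exact ⟨m + 1, fun n hn => (hdisj m (m + 1 + n) (by omega)).ne_of_mem hm hn rfl⟩
    · push Not at h
      exact ⟨0, fun n => h _⟩
  obtain ⟨⟨x₀, hx₀⟩⟩ := (hconn (N + 0)).nonempty
  obtain _ | ⟨i, v₀⟩ := x₀
  · exact absurd hx₀ (hN 0)
  have hin : ∀ n, ∃ v : V i, some ⟨i, v⟩ ∈ B (N + n) := by
    intro n
    rcases Nat.eq_zero_or_pos n with rfl | hn
    · exact ⟨v₀, hx₀⟩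
    obtain ⟨x, hx, y, hy, hxy⟩ := hadj (N + 0) (N + n) (by simp; omega)
    obtain ⟨w, hw, -⟩ := exists_reachable_of_coneSum (hN 0)
      ((hconn (N + 0)).preconnected ⟨_, hx₀⟩ ⟨x, hx⟩) v₀ rfl
    obtain rfl : x = some ⟨i, w⟩ := hw
    have hxy' : ConeSumAdj G _ _ := hxy
    cases hxy' with
    | apex_right => exact absurd hy (hN n)
    | base => exact ⟨_, hy⟩
  have hall : ∀ n, ∀ x ∈ B (N + n), ∃ v : V i, x = some ⟨i, v⟩ := by
    intro n x hx
    obtain ⟨v, hv⟩ := hin n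
    obtain ⟨w, hw, -⟩ := exists_reachable_of_coneSum (hN n)
      ((hconn (N + n)).preconnected ⟨_, hv⟩ ⟨x, hx⟩) v rfl
    exact ⟨w, hw⟩
  refine ⟨i, fun n => {v | some ⟨i, v⟩ ∈ B (N + n)}, fun n => ?_, fun m n hmn => ?_,
    fun m n hmn => ?_⟩
  · obtain ⟨v, hv⟩ := hin n
    refine (connected_iff _).2 ⟨?_, ⟨⟨v, hv⟩⟩⟩
    rintro ⟨a, ha⟩ ⟨b, hb⟩
    obtain ⟨w, hw, hr⟩ := exists_reachable_of_coneSum (hN n)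
      ((hconn (N + n)).preconnected ⟨_, ha⟩ ⟨_, hb⟩) a rfl
    obtain rfl : b = w := by simpa using hw
    exact hr
  · exact Set.disjoint_left.2 fun v hv hv' =>
      (hdisj (N + m) (N + n) (by omega)).ne_of_mem hv hv' rfl
  · obtain ⟨x, hx, y, hy, hxy⟩ := hadj (N + m) (N + n) (by simpa using hmn)
    obtain ⟨v, rfl⟩ := hall m x hx
    obtain ⟨w, rfl⟩ := hall n y hy
    have hxy' : ConeSumAdj G _ _ := hxy
    cases hxy' with
    | base h => exact ⟨v, hx, w, hy, h⟩

end coneSum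

/-- For every countable set of countable graphs without infinite complete minor there is another
such graph that is a minor of none of them. -/
theorem exists_not_isMinor {F : Set CGraph} (hF : F.Countable)
    (hK : ∀ G ∈ F, ¬ IsMinor (⊤ : SimpleGraph ℕ) G.graph) :
    ∃ H : CGraph, ¬ IsMinor (⊤ : SimpleGraph ℕ) H.graph ∧
      ∀ G ∈ F, ¬ IsMinor H.graph G.graph := by
  have : Countable F := hF
  let e := equivShrink.{0} F
  have hc : ∀ i, Countable (e.symm i).1.V := fun i => (e.symm i).1.countable
  have : Countable (Shrink.{0} F) := e.symm.injective.countable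
  refine ⟨⟨Option (Σ i, (e.symm i).1.V), inferInstance,
    coneSum fun i => (e.symm i).1.graph⟩, fun h => ?_, fun G hG h => ?_⟩
  · obtain ⟨i, hi⟩ := exists_isMinor_top_of_coneSum h
    exact hK _ (e.symm i).2 hi
  · obtain ⟨i, hi⟩ := e.symm.surjective ⟨G, hG⟩
    obtain rfl : (e.symm i).1 = G := congrArg Subtype.val hi
    exact hK _ hG (isMinor_top_of_coneSum (G := fun i => (e.symm i).1.graph) h)

/-- There is an uncountable family of countable graphs no two distinct members of which
are minor-twins; i.e. the minor-twin equivalence relation on countable graphs has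
uncountably many classes. -/
theorem uncountably_many_minor_twin_classes :
    ∃ F : Set CGraph, ¬ F.Countable ∧
      ∀ G ∈ F, ∀ H ∈ F, G ≠ H → ¬ MinorTwins G H := by
  obtain ⟨F, hF⟩ := zorn_subset
    {F : Set CGraph | (∀ G ∈ F, ¬ IsMinor (⊤ : SimpleGraph ℕ) G.graph) ∧
      F.Pairwise fun G H => ¬ MinorTwins G H} (by
    intro c hc hchain
    refine ⟨⋃₀ c, ⟨?_, ?_⟩, fun s hs => Set.subset_sUnion_of_mem hs⟩
    · rintro G ⟨s, hs, hG⟩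
      exact (hc hs).1 G hG
    · exact (Set.pairwise_sUnion hchain.directedOn).2 fun s hs => (hc hs).2)
  refine ⟨F, fun hcount => ?_, fun G hG H hH hne => hF.prop.2 hG hH hne⟩
  obtain ⟨H, hHK, hH⟩ := exists_not_isMinor hcount hF.prop.1
  refine hH H (hF.mem_of_prop_insert ⟨?_, ?_⟩) (IsMinor.refl _)
  · rintro G (rfl | hG)
    · exact hHK
    · exact hF.prop.1 G hG
  · exact hF.prop.2.insert fun G hG _ => ⟨fun h => hH G hG h.1, fun h => hH G hG h.2⟩
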